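/- arXiv:0902.2507 — 3 statements merged into one kernel-verified Lean document; each statement's English description precedes it below -/
import Mathlib

section
/- Let p ≥ 2 be a real number and let a, b ∈ ℝ^n. Then 2^{2−p}·‖a−b‖^p ≤ ⟨‖a‖^{p−2}·a − ‖b‖^{p−2}·b, a−b⟩, where ⟨·,·⟩ denotes the standard inner product on ℝ^n and ‖·‖ the Euclidean norm. -/
open RealInnerProductSpace

lemma rpow_sub_two_mul_self {p x : ℝ} (hp : 2 ≤ p) (hx : 0 ≤ x) :
    x ^ (p - 2) * x = x ^ (p - 1) := by
  rw [← Real.rpow_add_one' hx (by linarith)]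
  ring_nf

lemma rpow_sub_one_mul_self {p x : ℝ} (hp : 2 ≤ p) (hx : 0 ≤ x) :
    x ^ (p - 1) * x = x ^ p := by
  rw [← Real.rpow_add_one' hx (by linarith)]
  ring_nf

/-- The case of two parallel vectors pointing in the same direction. -/
lemma two_rpow_mul_sub_rpow_le {p x y : ℝ} (hp : 2 ≤ p) (hy : 0 ≤ y) (hyx : y ≤ x) :
    (2 : ℝ) ^ (2 - p) * (x - y) ^ p ≤ (x ^ (p - 1) - y ^ (p - 1)) * (x - y) := by
  have hd : 0 ≤ x - y := sub_nonneg.2 hyx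
  have h2 : (2 : ℝ) ^ (2 - p) ≤ 1 :=
    Real.rpow_le_one_of_one_le_of_nonpos one_le_two (by linarith)
  have hsup := Real.add_rpow_le_rpow_add hd hy (p := p - 1) (by linarith)
  rw [sub_add_cancel] at hsup
  calc (2 : ℝ) ^ (2 - p) * (x - y) ^ p ≤ (x - y) ^ p :=
        mul_le_of_le_one_left (Real.rpow_nonneg hd p) h2
    _ = (x - y) ^ (p - 1) * (x - y) := (rpow_sub_one_mul_self hp hd).symm
    _ ≤ _ := mul_le_mul_of_nonneg_right (by linarith) hd

/-- The case of two parallel vectors pointing in opposite directions. -/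
lemma two_rpow_mul_add_rpow_le {p x y : ℝ} (hp : 2 ≤ p) (hx : 0 ≤ x) (hy : 0 ≤ y) :
    (2 : ℝ) ^ (2 - p) * (x + y) ^ p ≤ (x ^ (p - 1) + y ^ (p - 1)) * (x + y) := by
  have hs : 0 ≤ x + y := add_nonneg hx hy
  have hmean : (x + y) ^ (p - 1) ≤ 2 ^ (p - 1 - 1) * (x ^ (p - 1) + y ^ (p - 1)) := by
    lift x to NNReal using hx
    lift y to NNReal using hy
    exact_mod_cast NNReal.rpow_add_le_mul_rpow_add_rpow x y (p := p - 1) (by linarith)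
  have h2 : (2 : ℝ) ^ (2 - p) * 2 ^ (p - 1 - 1) = 1 := by
    rw [← Real.rpow_add two_pos]
    ring_nf
    exact Real.rpow_zero 2
  rw [← rpow_sub_one_mul_self hp hs, ← mul_assoc]
  refine mul_le_mul_of_nonneg_right ?_ hs
  calc (2 : ℝ) ^ (2 - p) * (x + y) ^ (p - 1)
      ≤ 2 ^ (2 - p) * (2 ^ (p - 1 - 1) * (x ^ (p - 1) + y ^ (p - 1))) := by gcongr
    _ = _ := by rw [← mul_assoc, h2, one_mul]

/-- The inequality for vectors of lengths `x`, `y` at distance `d`, with the inner product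
expressed through `x`, `y` and `d`. -/
lemma two_rpow_mul_rpow_le_of_le {p x y d : ℝ} (hp : 2 ≤ p) (hy : 0 ≤ y) (hyx : y ≤ x)
    (hd : x - y ≤ d) (hd' : d ≤ x + y) :
    (2 : ℝ) ^ (2 - p) * d ^ p ≤ (x ^ (p - 2) + y ^ (p - 2)) / 2 * d ^ 2 +
      (x ^ (p - 2) - y ^ (p - 2)) * (x ^ 2 - y ^ 2) / 2 := by
  have hx : 0 ≤ x := hy.trans hyx
  have hxy : 0 ≤ x - y := sub_nonneg.2 hyx
  have hd0 : 0 ≤ d := hxy.trans hd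
  have hsq {t : ℝ} (ht : 0 ≤ t) : (t ^ 2) ^ (p / 2) = t ^ p := by
    rw [← Real.rpow_natCast_mul ht]
    congr 1
    push_cast
    ring
  set A := (x ^ (p - 2) + y ^ (p - 2)) / 2 with hA
  set B := (x ^ (p - 2) - y ^ (p - 2)) * (x ^ 2 - y ^ 2) / 2 with hB
  have hconv : ConvexOn ℝ (Set.Ici 0)
      (fun s : ℝ ↦ (2 : ℝ) ^ (2 - p) * s ^ (p / 2) + -(A * s)) := by
    refine ((convexOn_rpow (by linarith : 1 ≤ p / 2)).smul (by positivity)).add ?_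
    exact ((LinearMap.mulLeft ℝ A).concaveOn (convex_Ici 0)).neg
  have hmax := hconv.le_max_of_mem_Icc (x := (x - y) ^ 2) (y := (x + y) ^ 2) (z := d ^ 2)
    (Set.mem_Ici.2 (sq_nonneg _)) (Set.mem_Ici.2 (sq_nonneg _))
    ⟨pow_le_pow_left₀ hxy hd 2, pow_le_pow_left₀ hd0 hd' 2⟩
  simp only [hsq hxy, hsq hd0, hsq (add_nonneg hx hy)] at hmax
  have hsub := two_rpow_mul_sub_rpow_le hp hy hyx
  have hadd := two_rpow_mul_add_rpow_le hp hx hy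
  rw [← rpow_sub_two_mul_self hp hx, ← rpow_sub_two_mul_self hp hy] at hsub hadd
  have hbound : max ((2 : ℝ) ^ (2 - p) * (x - y) ^ p + -(A * (x - y) ^ 2))
      (2 ^ (2 - p) * (x + y) ^ p + -(A * (x + y) ^ 2)) ≤ B := by
    apply max_le <;> rw [hA, hB] <;> linarith
  linarith

/-- For a real exponent `p ≥ 2` and vectors `a b` in Euclidean `n`-space,
`2^(2-p) * ‖a - b‖^p ≤ ⟨‖a‖^(p-2) • a - ‖b‖^(p-2) • b, a - b⟩`. -/
theorem pLaplacian_monotonicity_of_two_le {n : ℕ} (p : ℝ) (hp : 2 ≤ p)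
    (a b : EuclideanSpace ℝ (Fin n)) :
    (2 : ℝ) ^ (2 - p) * ‖a - b‖ ^ p ≤
      ⟪(‖a‖ ^ (p - 2)) • a - (‖b‖ ^ (p - 2)) • b, a - b⟫ := by
  have hinner : ⟪(‖a‖ ^ (p - 2)) • a - (‖b‖ ^ (p - 2)) • b, a - b⟫ =
      (‖a‖ ^ (p - 2) + ‖b‖ ^ (p - 2)) / 2 * ‖a - b‖ ^ 2 +
        (‖a‖ ^ (p - 2) - ‖b‖ ^ (p - 2)) * (‖a‖ ^ 2 - ‖b‖ ^ 2) / 2 := by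
    rw [norm_sub_sq_real]
    simp only [inner_sub_left, inner_sub_right, real_inner_smul_left,
      real_inner_self_eq_norm_sq, real_inner_comm a b]
    ring
  rw [hinner]
  rcases le_total ‖b‖ ‖a‖ with h | h
  · exact two_rpow_mul_rpow_le_of_le hp (norm_nonneg b) h (norm_sub_norm_le a b)
      (norm_sub_le a b)
  · have := two_rpow_mul_rpow_le_of_le hp (norm_nonneg a) h (norm_sub_norm_le b a)
      (norm_sub_le b a)
    rw [norm_sub_rev b a] at this
    linarith
end

section
/- Let 1 < p < 2 be a real number and let a, b ∈ ℝ^n with (a,b) ≠ (0,0). Then (p−1)·‖a−b‖²·(‖a‖+‖b‖)^{p−2} ≤ ⟨‖a‖^{p−2}·a − ‖b‖^{p−2}·b, a−b⟩, where ⟨·,·⟩ denotes the standard inner product on ℝ^n and ‖·‖ the Euclidean norm (with the convention that ‖c‖^{p−2}·c = 0 when c = 0). -/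
open RealInnerProductSpace

/-- The tangent line of `u ↦ u ^ q` at `x` lies above its graph when `0 ≤ q ≤ 1`. -/
theorem rpow_le_rpow_add_tangent {q x y : ℝ} (hq0 : 0 ≤ q) (hq1 : q ≤ 1)
    (hx : 0 < x) (hy : 0 ≤ y) :
    y ^ q ≤ x ^ q + q * x ^ (q - 1) * (y - x) := by
  have hyx : 0 ≤ y / x := by positivity
  have h := rpow_one_add_le_one_add_mul_self (s := y / x - 1) (by linarith) hq0 hq1
  rw [add_sub_cancel, Real.div_rpow hy hx.le, div_le_iff₀ (Real.rpow_pos_of_pos hx q)] at h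
  rw [Real.rpow_sub_one hx.ne']
  calc y ^ q ≤ (1 + q * (y / x - 1)) * x ^ q := h
    _ = x ^ q + q * (x ^ q / x) * (y - x) := by field_simp

/-- The one-dimensional monotonicity estimate for nonnegative reals. -/
theorem mul_sub_mul_rpow_add_le {p x y : ℝ} (hp1 : 1 < p) (hp2 : p < 2)
    (hy : 0 ≤ y) (hyx : y ≤ x) (hx : 0 < x) :
    (p - 1) * (x - y) * (x + y) ^ (p - 2) ≤ x ^ (p - 2) * x - y ^ (p - 2) * y := by
  have h := rpow_le_rpow_add_tangent (q := p - 1) (by linarith) (by linarith) hx hy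
  have hpow : ∀ z : ℝ, 0 ≤ z → z ^ (p - 1) = z ^ (p - 2) * z := fun z hz => by
    rw [← Real.rpow_add_one' hz (by linarith)]
    ring_nf
  rw [hpow x hx.le, hpow y hy, show p - 1 - 1 = p - 2 by ring] at h
  have hS : (x + y) ^ (p - 2) ≤ x ^ (p - 2) :=
    Real.rpow_le_rpow_of_nonpos hx (by linarith) (by linarith)
  have hc : 0 ≤ (p - 1) * (x - y) := mul_nonneg (by linarith) (by linarith)
  linarith [mul_le_mul_of_nonneg_left hS hc]

theorem pLaplacian_monotonicity_of_norm_le {E : Type*} [NormedAddCommGroup E]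
    [InnerProductSpace ℝ E] {p : ℝ} (hp1 : 1 < p) (hp2 : p < 2) {a b : E}
    (ha : a ≠ 0) (hba : ‖b‖ ≤ ‖a‖) :
    (p - 1) * ‖a - b‖ ^ (2 : ℝ) * (‖a‖ + ‖b‖) ^ (p - 2) ≤
      ⟪(‖a‖ ^ (p - 2)) • a - (‖b‖ ^ (p - 2)) • b, a - b⟫ := by
  have hx : 0 < ‖a‖ := norm_pos_iff.mpr ha
  have hscalar := mul_le_mul_of_nonneg_right
    (mul_sub_mul_rpow_add_le hp1 hp2 (norm_nonneg b) hba hx) (sub_nonneg.mpr hba)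
  have hcross : 0 ≤ (‖a‖ * ‖b‖ - ⟪a, b⟫) *
      (‖a‖ ^ (p - 2) + ‖b‖ ^ (p - 2) - 2 * (p - 1) * (‖a‖ + ‖b‖) ^ (p - 2)) := by
    rcases eq_or_ne b 0 with rfl | hb
    · simp
    have hy : 0 < ‖b‖ := norm_pos_iff.mpr hb
    have hA : (‖a‖ + ‖b‖) ^ (p - 2) ≤ ‖a‖ ^ (p - 2) :=
      Real.rpow_le_rpow_of_nonpos hx (by linarith) (by linarith)
    have hB : (‖a‖ + ‖b‖) ^ (p - 2) ≤ ‖b‖ ^ (p - 2) :=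
      Real.rpow_le_rpow_of_nonpos hy (by linarith) (by linarith)
    have hS : 0 ≤ (‖a‖ + ‖b‖) ^ (p - 2) := by positivity
    refine mul_nonneg (sub_nonneg.mpr (real_inner_le_norm a b)) ?_
    nlinarith [mul_nonneg (sub_nonneg.mpr hp2.le) hS]
  rw [Real.rpow_two, norm_sub_sq_real]
  simp only [inner_sub_left, inner_sub_right, real_inner_smul_left, real_inner_self_eq_norm_sq,
    real_inner_comm a b]
  linarith

/-- For a real exponent `1 < p < 2` and vectors `a b` in Euclidean `n`-space,
not both zero, `(p-1) * ‖a - b‖^2 * (‖a‖ + ‖b‖)^(p-2) ≤ ⟨‖a‖^(p-2) • a - ‖b‖^(p-2) • b, a - b⟩`.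
(With the real-power convention, `‖c‖ ^ (p - 2) = 0` when `c = 0`, so `‖c‖^(p-2) • c = 0`.) -/
theorem pLaplacian_monotonicity_of_lt_two {n : ℕ} (p : ℝ) (hp1 : 1 < p) (hp2 : p < 2)
    (a b : EuclideanSpace ℝ (Fin n)) (hab : ¬(a = 0 ∧ b = 0)) :
    (p - 1) * ‖a - b‖ ^ (2 : ℝ) * (‖a‖ + ‖b‖) ^ (p - 2) ≤
      ⟪(‖a‖ ^ (p - 2)) • a - (‖b‖ ^ (p - 2)) • b, a - b⟫ := by
  rcases le_total ‖b‖ ‖a‖ with h | h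
  · refine pLaplacian_monotonicity_of_norm_le hp1 hp2 (fun ha => hab ⟨ha, ?_⟩) h
    simpa [ha] using h
  · have hb : b ≠ 0 := fun hb => hab ⟨by simpa [hb] using h, hb⟩
    have key := pLaplacian_monotonicity_of_norm_le hp1 hp2 hb h
    rwa [norm_sub_rev b a, add_comm ‖b‖, ← inner_neg_neg, neg_sub, neg_sub] at key
end

section
/- Let N ≥ 1 and let p : ℝ^N → ℝ be a Lipschitz-continuous function with 1 < inf_{ℝ^N} p ≤ sup_{ℝ^N} p < N, and set p*(x) = N·p(x)/(N − p(x)). Let Ω ⊆ ℝ^N be an open set. Then there exists a constant c > 0 such that for every smooth compactly supported function u ∈ C_c^∞(Ω), |u|_{p*(·)} ≤ c·(|u|_{p(·)} + |∇u|_{p(·)}), where |∇u| denotes the Euclidean norm of the gradient of u. -/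
open MeasureTheory Filter Topology

/-- The modular `ρ_{p(·)}(u) = ∫_Ω |u(x)|^{p(x)} dx` (as an extended nonnegative real);
`u` belongs to `L^{p(·)}(Ω)` iff this is finite. -/
noncomputable def modular {N : ℕ} (Ω : Set (EuclideanSpace ℝ (Fin N)))
    (p u : EuclideanSpace ℝ (Fin N) → ℝ) : ENNReal :=
  ∫⁻ x in Ω, ENNReal.ofReal (|u x| ^ p x)

/-- The Luxemburg norm `|u|_{p(·)} = inf {α > 0 : ∫_Ω |u(x)/α|^{p(x)} dx ≤ 1}`. -/
noncomputable def luxNorm {N : ℕ} (Ω : Set (EuclideanSpace ℝ (Fin N)))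
    (p u : EuclideanSpace ℝ (Fin N) → ℝ) : ℝ :=
  sInf {α : ℝ | 0 < α ∧ (∫⁻ x in Ω, ENNReal.ofReal (|u x / α| ^ p x)) ≤ 1}

/-- A weighted Young inequality for the exponents `q` and `q/(q-1)`, stated for the power of `y`
whose conjugate power is the critical exponent `n q / (n - q)`. -/
lemma rpow_mul_le_critical_add {n b q η y z : ℝ} (hq : 1 < q) (hqb : q ≤ b) (hqn : q < n)
    (hη : 0 < η) (hη1 : η ≤ 1) (hy : 0 ≤ y) (hz : 0 ≤ z) :
    y ^ ((n - 1) * q / (n - q) - 1) * z ≤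
      η * y ^ (n * q / (n - q)) + η⁻¹ ^ (b - 1) * z ^ q := by
  have hnq : 0 < n - q := sub_pos.2 hqn
  have hn : 0 < n := by linarith
  set k := n / (n - q) with hk
  have hk0 : 0 < k := div_pos hn hnq
  have e1 : (n - 1) * q / (n - q) - 1 = k * (q - 1) := by rw [hk]; field_simp; ring
  have e2 : n * q / (n - q) = k * (q - 1) + k := by rw [hk]; field_simp; ring
  have hkq : 0 ≤ k * (q - 1) := mul_nonneg hk0.le (by linarith)
  rw [e1, e2, Real.rpow_add_of_nonneg hy hkq hk0.le]
  have hA : 0 ≤ y ^ (k * (q - 1)) := Real.rpow_nonneg hy _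
  have hB : 0 ≤ η⁻¹ ^ (b - 1) * z ^ q := by positivity
  rcases le_total z (η * y ^ k) with h | h
  · calc _ ≤ y ^ (k * (q - 1)) * (η * y ^ k) := by gcongr
      _ ≤ _ := by linarith
  · have hyk : y ^ k ≤ η⁻¹ * z := by
      rw [← div_eq_inv_mul, le_div_iff₀ hη]; linarith
    have h1 : y ^ (k * (q - 1)) ≤ η⁻¹ ^ (q - 1) * z ^ (q - 1) := by
      rw [Real.rpow_mul hy, ← Real.mul_rpow (by positivity) hz]
      exact Real.rpow_le_rpow (by positivity) hyk (by linarith)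
    have h2 : η⁻¹ ^ (q - 1) ≤ η⁻¹ ^ (b - 1) :=
      Real.rpow_le_rpow_of_exponent_le ((one_le_inv₀ hη).2 hη1) (by linarith)
    have h3 : z ^ (q - 1) * z = z ^ q := by
      conv_lhs => rw [← Real.rpow_one z, ← Real.rpow_mul hz, one_mul]
      rw [← Real.rpow_add_of_nonneg hz (by linarith) zero_le_one]
      simp
    calc _ ≤ η⁻¹ ^ (q - 1) * z ^ (q - 1) * z := by gcongr
      _ = η⁻¹ ^ (q - 1) * z ^ q := by rw [mul_assoc, h3]
      _ ≤ η⁻¹ ^ (b - 1) * z ^ q := by gcongr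
      _ ≤ _ := by
        have : 0 ≤ η * (y ^ (k * (q - 1)) * y ^ k) := by positivity
        linarith

/-- A power times a logarithm is controlled by a small multiple of a higher power plus a large
multiple of a lower power, uniformly in the exponents. -/
lemma exists_rpow_mul_abs_log_le {δ M η : ℝ} (hδ : 0 < δ) (hη : 0 < η) :
    ∃ C : ℝ, 0 ≤ C ∧ ∀ q s r y : ℝ, 0 < q → q + δ ≤ s → s ≤ q + M → s + δ ≤ r → 0 ≤ y →
      y ^ s * |Real.log y| ≤ η * y ^ r + C * y ^ q := by
  obtain ⟨R, hR⟩ := Filter.eventually_atTop.1 ((isLittleO_log_rpow_atTop hδ).def hη)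
  set R' := max R 1
  have hR1 : 1 ≤ R' := le_max_right _ _
  have hlogR : 0 ≤ Real.log R' := Real.log_nonneg hR1
  refine ⟨1 / δ + R' ^ M * Real.log R', by positivity, fun q s r y hq hqs hsM hsr hy => ?_⟩
  have hs : 0 < s := by linarith
  rcases hy.eq_or_lt with rfl | hy0
  · simp [Real.zero_rpow hs.ne', Real.zero_rpow hq.ne', Real.zero_rpow (show r ≠ 0 by linarith)]
  have hyr : 0 ≤ η * y ^ r := by positivity
  have hyq : 0 ≤ y ^ q := by positivity
  have hyqs : y ^ s = y ^ (s - q) * y ^ q := by rw [← Real.rpow_add hy0]; ring_nf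
  have key : y ^ (s - q) * |Real.log y| ≤ 1 / δ + R' ^ M * Real.log R' →
      y ^ s * |Real.log y| ≤ η * y ^ r + (1 / δ + R' ^ M * Real.log R') * y ^ q := fun h => by
    calc y ^ s * |Real.log y| = y ^ (s - q) * |Real.log y| * y ^ q := by rw [hyqs]; ring
      _ ≤ (1 / δ + R' ^ M * Real.log R') * y ^ q := by gcongr
      _ ≤ _ := by linarith
  rcases le_total y 1 with h1 | h1
  · apply key
    have h2 := Real.abs_log_mul_self_rpow_lt y δ hy0 h1 hδ
    rw [abs_mul, abs_of_nonneg (Real.rpow_nonneg hy δ)] at h2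
    have h3 : y ^ (s - q) ≤ y ^ δ := Real.rpow_le_rpow_of_exponent_ge hy0 h1 (by linarith)
    have h4 : 0 ≤ R' ^ M * Real.log R' := by positivity
    nlinarith [mul_le_mul_of_nonneg_right h3 (abs_nonneg (Real.log y))]
  · have hlog : 0 ≤ Real.log y := Real.log_nonneg h1
    rcases le_total y R' with h2 | h2
    · apply key
      rw [abs_of_nonneg hlog]
      have h3 : y ^ (s - q) ≤ R' ^ M :=
        (Real.rpow_le_rpow hy h2 (by linarith)).trans
          (Real.rpow_le_rpow_of_exponent_le hR1 (by linarith))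
      have h4 : Real.log y ≤ Real.log R' := Real.log_le_log hy0 h2
      have h5 : y ^ (s - q) * Real.log y ≤ R' ^ M * Real.log R' := by gcongr
      have : 0 < 1 / δ := by positivity
      linarith
    · have h3 := hR y ((le_max_left _ _).trans h2)
      rw [Real.norm_eq_abs, Real.norm_eq_abs, abs_of_nonneg (Real.rpow_nonneg hy δ)] at h3
      have h4 : y ^ s * y ^ δ ≤ y ^ r := by
        rw [← Real.rpow_add hy0]
        exact Real.rpow_le_rpow_of_exponent_le h1 hsr
      calc y ^ s * |Real.log y| ≤ y ^ s * (η * y ^ δ) := by gcongr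
        _ = η * (y ^ s * y ^ δ) := by ring
        _ ≤ η * y ^ r := by gcongr
        _ ≤ _ := by
          have : 0 ≤ (1 / δ + R' ^ M * Real.log R') * y ^ q := by positivity
          linarith

/-- The terms of the gradient of `|v| ^ s`, with `s = (n - 1) q / (n - q)`, are absorbed by a small
multiple of the critical power, uniformly for `q` in a compact subinterval of `(1, n)`. -/
lemma exists_critical_absorption {n a b L η : ℝ} (ha : 1 < a) (hb : b < n) (hab : a ≤ b)
    (hL : 0 ≤ L) (hη : 0 < η) :
    ∃ D : ℝ, 0 ≤ D ∧ ∀ q y z : ℝ, a ≤ q → q ≤ b → 0 ≤ y → 0 ≤ z →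
      (n - 1) * q / (n - q) * y ^ ((n - 1) * q / (n - q) - 1) * z +
        y ^ ((n - 1) * q / (n - q)) * |Real.log y| * L ≤
      η * y ^ (n * q / (n - q)) + D * (y ^ q + z ^ q) := by
  have hn : 1 < n := by linarith
  have hnb : 0 < n - b := by linarith
  set S := n * n / (n - b)
  have hS : 0 < S := by positivity
  set η₁ := min 1 (η / (2 * S))
  have hη₁ : 0 < η₁ := by positivity
  set δ := min (1 / n) ((a - 1) / n)
  have hδ : 0 < δ := lt_min (by positivity) (div_pos (by linarith) (by linarith))
  obtain ⟨C, hC, hlog⟩ :=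
    exists_rpow_mul_abs_log_le (M := S) hδ (show 0 < η / (2 * (L + 1)) by positivity)
  refine ⟨S * η₁⁻¹ ^ (b - 1) + L * C, by positivity, fun q y z haq hqb hy hz => ?_⟩
  have hnq : 0 < n - q := by linarith
  have hq : 1 < q := by linarith
  have hy1 := rpow_mul_le_critical_add (n := n) (z := z) hq hqb (by linarith) hη₁
    (min_le_left _ _) hy hz
  have hsS : (n - 1) * q / (n - q) ≤ S := by
    apply div_le_div₀ (by positivity) (by nlinarith) hnb (by linarith)
  have hs0 : 0 ≤ (n - 1) * q / (n - q) :=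
    div_nonneg (mul_nonneg (by linarith) (by linarith)) hnq.le
  have hl := hlog q ((n - 1) * q / (n - q)) (n * q / (n - q)) y (by linarith)
    (by
      have : (n - 1) * q / (n - q) = q + q * (q - 1) / (n - q) := by field_simp; ring
      rw [this]
      have h2 : (a - 1) / n ≤ q * (q - 1) / (n - q) :=
        div_le_div₀ (by nlinarith) (by nlinarith) hnq (by linarith)
      linarith [min_le_right (1 / n) ((a - 1) / n)])
    (by linarith)
    (by
      have : n * q / (n - q) = (n - 1) * q / (n - q) + q / (n - q) := by field_simp; ring
      rw [this]
      have h2 : 1 / n ≤ q / (n - q) :=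
        div_le_div₀ (by linarith) hq.le hnq (by linarith)
      linarith [min_le_left (1 / n) ((a - 1) / n)])
    hy
  set s := (n - 1) * q / (n - q)
  set r := n * q / (n - q)
  have hSη : S * η₁ ≤ η / 2 := by
    calc S * η₁ ≤ S * (η / (2 * S)) := by gcongr; exact min_le_right _ _
      _ = η / 2 := by field_simp
  have hLη : L * (η / (2 * (L + 1))) ≤ η / 2 := by
    rw [mul_div_assoc', div_le_div_iff₀ (by positivity) (by positivity)]
    nlinarith
  have hyr : 0 ≤ y ^ r := Real.rpow_nonneg hy _
  have hyq : 0 ≤ y ^ q := Real.rpow_nonneg hy _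
  have hzq : 0 ≤ z ^ q := Real.rpow_nonneg hz _
  have hys : 0 ≤ y ^ (s - 1) * z := mul_nonneg (Real.rpow_nonneg hy _) hz
  have hE : 0 ≤ S * η₁⁻¹ ^ (b - 1) := by positivity
  calc s * y ^ (s - 1) * z + y ^ s * |Real.log y| * L
      ≤ S * (η₁ * y ^ r + η₁⁻¹ ^ (b - 1) * z ^ q) +
        (η / (2 * (L + 1)) * y ^ r + C * y ^ q) * L := by
        rw [mul_assoc s]; gcongr
    _ = (S * η₁ + L * (η / (2 * (L + 1)))) * y ^ r + S * η₁⁻¹ ^ (b - 1) * z ^ q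
        + L * C * y ^ q := by ring
    _ ≤ η * y ^ r + S * η₁⁻¹ ^ (b - 1) * z ^ q + L * C * y ^ q := by
        gcongr; linarith
    _ ≤ _ := by nlinarith [mul_nonneg hE hyq, mul_nonneg (mul_nonneg hL hC) hzq]

section AbsRpow

variable {E : Type*} [NormedAddCommGroup E] [NormedSpace ℝ E] {v s : E → ℝ}

lemma norm_abs_rpow_smul_le {y t : ℝ} (ht : 0 < t) (A B : E →L[ℝ] ℝ) :
    ‖|y| ^ t • ((t * y⁻¹) • A + Real.log y • B)‖ ≤
      t * |y| ^ (t - 1) * ‖A‖ + |y| ^ t * |Real.log y| * ‖B‖ := by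
  rcases eq_or_ne y 0 with rfl | hy
  · simp only [abs_zero, Real.zero_rpow ht.ne', zero_smul, norm_zero]
    positivity
  have hy' : 0 < |y| := abs_pos.2 hy
  calc ‖|y| ^ t • ((t * y⁻¹) • A + Real.log y • B)‖
      = |y| ^ t * ‖(t * y⁻¹) • A + Real.log y • B‖ := by
        rw [norm_smul, Real.norm_of_nonneg (by positivity)]
    _ ≤ |y| ^ t * (t * |y|⁻¹ * ‖A‖ + |Real.log y| * ‖B‖) := by
        gcongr
        refine (norm_add_le _ _).trans_eq ?_
        rw [norm_smul, norm_smul, norm_mul, norm_inv, Real.norm_of_nonneg ht.le, Real.norm_eq_abs,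
          Real.norm_eq_abs]
    _ = _ := by rw [Real.rpow_sub_one hy'.ne']; ring

lemma hasFDerivAt_abs_rpow {v' s' : E →L[ℝ] ℝ} {x : E} (hv : HasFDerivAt v v' x)
    (hs : HasFDerivAt s s' x) (h1 : 1 < s x) :
    HasFDerivAt (fun x => |v x| ^ s x)
      (|v x| ^ s x • ((s x * (v x)⁻¹) • v' + Real.log (v x) • s')) x := by
  rcases eq_or_ne (v x) 0 with h0 | h0
  · have hd : |v x| ^ s x • ((s x * (v x)⁻¹) • v' + Real.log (v x) • s') = 0 := by
      rw [h0, abs_zero, Real.zero_rpow (by linarith), zero_smul]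
    rw [hd, hasFDerivAt_iff_isLittleO_nhds_zero]
    have hO : (fun h => v (x + h)) =O[𝓝 0] fun h : E => h := by
      have h2 := hv.isBigO_sub
      rw [h0] at h2
      have ht : Tendsto (fun h : E => x + h) (𝓝 0) (𝓝 x) := by
        simpa using! (continuous_const_add x).tendsto (0 : E)
      simpa [Function.comp_def] using! h2.comp_tendsto ht
    have hcs : ContinuousAt (fun h => s (x + h)) (0 : E) :=
      ContinuousAt.comp (g := s) (by simpa using hs.continuousAt) (by fun_prop)
    have ho : (fun h => |v (x + h)| ^ (s (x + h) - 1)) =o[𝓝 0] fun _ : E => (1 : ℝ) := by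
      rw [Asymptotics.isLittleO_one_iff]
      have hcv : ContinuousAt (fun h => v (x + h)) (0 : E) :=
        ContinuousAt.comp (g := v) (by simpa using hv.continuousAt) (by fun_prop)
      have := (hcv.abs.rpow (hcs.sub_const 1) (Or.inr (by simpa using h1))).tendsto
      simpa [h0, Real.zero_rpow (sub_pos.2 h1).ne'] using this
    have hprod := hO.norm_norm.mul_isLittleO ho
    simp only [mul_one] at hprod
    refine (hprod.congr' ?_ EventuallyEq.rfl).of_norm_right
    have hs1 : ∀ᶠ h in 𝓝 (0 : E), 1 < s (x + h) :=
      hcs.eventually (lt_mem_nhds (by simpa using h1))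
    filter_upwards [hs1] with h hh
    rw [h0, abs_zero, Real.zero_rpow (by linarith), Real.norm_eq_abs, mul_comm,
      ← Real.rpow_add_one' (abs_nonneg _) (by linarith), sub_add_cancel]
    simp
  · have h2 := ((hv.log h0).mul hs).exp
    have he : ∀ᶠ y in 𝓝 x, v y ≠ 0 := hv.continuousAt.eventually_ne h0
    refine (h2.congr_of_eventuallyEq ?_).congr_fderiv ?_
    · filter_upwards [he] with y hy
      rw [Real.rpow_def_of_pos (abs_pos.2 hy), Real.log_abs]
      rfl
    · rw [Real.rpow_def_of_pos (abs_pos.2 h0), Real.log_abs, smul_smul, add_comm]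
      rfl

lemma contDiff_one_abs_rpow (hv : ContDiff ℝ 1 v) (hs : ContDiff ℝ 1 s) (h1 : ∀ x, 1 < s x) :
    ContDiff ℝ 1 (fun x => |v x| ^ s x) := by
  have hd : ∀ x, HasFDerivAt (fun x => |v x| ^ s x) (|v x| ^ s x •
      ((s x * (v x)⁻¹) • fderiv ℝ v x + Real.log (v x) • fderiv ℝ s x)) x := fun x =>
    hasFDerivAt_abs_rpow (hv.differentiable one_ne_zero x).hasFDerivAt
      (hs.differentiable one_ne_zero x).hasFDerivAt (h1 x)
  refine contDiff_one_iff_fderiv.2 ⟨fun x => (hd x).differentiableAt, ?_⟩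
  rw [funext fun x => (hd x).fderiv]
  have hv' := hv.continuous_fderiv one_ne_zero
  have hs' := hs.continuous_fderiv one_ne_zero
  have hvc := hv.continuous
  have hsc := hs.continuous
  refine continuous_iff_continuousAt.2 fun x => ?_
  rcases eq_or_ne (v x) 0 with h0 | h0
  · have hz : |v x| ^ s x = 0 := by rw [h0, abs_zero, Real.zero_rpow (by linarith [h1 x])]
    rw [ContinuousAt, hz, zero_smul]
    refine squeeze_zero_norm (fun y => norm_abs_rpow_smul_le (by linarith [h1 y]) _ _) ?_
    have hc1 : Continuous fun y => |v y| ^ (s y - 1) :=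
      hvc.abs.rpow (hsc.sub continuous_const) fun y => Or.inr (by linarith [h1 y])
    have hc2 : Continuous fun y => |v y| * Real.log (v y) :=
      by
      simpa only [Function.comp_def, Real.log_abs] using Real.continuous_mul_log.comp hvc.abs
    have hc : Continuous fun y => s y * |v y| ^ (s y - 1) * ‖fderiv ℝ v y‖ +
        |v y| ^ (s y - 1) * |(|v y| * Real.log (v y))| * ‖fderiv ℝ s y‖ := by fun_prop
    have h2 := hc.tendsto x
    simp only [h0, abs_zero, Real.zero_rpow (sub_pos.2 (h1 x)).ne', mul_zero, zero_mul,
      add_zero] at h2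
    refine h2.congr fun y => ?_
    rw [abs_mul, abs_abs, ← mul_assoc (|v y| ^ (s y - 1)), ← Real.rpow_add_one' (abs_nonneg _)
      (by linarith [h1 y]), sub_add_cancel]
  · have hr : ContinuousAt (fun x => |v x| ^ s x) x :=
      hvc.continuousAt.abs.rpow hsc.continuousAt (Or.inl (abs_pos.2 h0).ne')
    exact hr.smul (((hsc.continuousAt.mul (hvc.continuousAt.inv₀ h0)).smul
      hv'.continuousAt).add ((hvc.continuousAt.log h0).smul hs'.continuousAt))

end AbsRpow

open scoped Convolution in
/-- Lipschitz functions on a Euclidean space are pointwise limits of `C¹` functions obeying the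
same bounds. -/
lemma LipschitzWith.exists_contDiff_tendsto {E : Type*} [NormedAddCommGroup E]
    [InnerProductSpace ℝ E] [FiniteDimensional ℝ E] [MeasurableSpace E] [BorelSpace E]
    {p : E → ℝ} {K : NNReal} {a b : ℝ} (hp : LipschitzWith K p) (ha : ∀ x, a ≤ p x) (hb : ∀ x, p x ≤ b) :
    ∃ q : ℕ → E → ℝ, (∀ k, ContDiff ℝ 1 (q k)) ∧ (∀ k x, ‖fderiv ℝ (q k) x‖ ≤ K) ∧
      (∀ k x, a ≤ q k x) ∧ (∀ k x, q k x ≤ b) ∧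
      ∀ x, Tendsto (fun k => q k x) atTop (𝓝 (p x)) := by
  let μ : Measure E := Measure.addHaar
  let φ : ℕ → ContDiffBump (0 : E) := fun k =>
    ⟨1 / ((k : ℝ) + 1) / 2, 1 / ((k : ℝ) + 1), by positivity, half_lt_self (by positivity)⟩
  have hpc := hp.continuous
  have hint : ∀ k x, Integrable (fun t => (φ k).normed μ t * p (x - t)) μ := fun k x =>
    ((φ k).continuous_normed.mul (hpc.comp (continuous_const.sub continuous_id))
      ).integrable_of_hasCompactSupport ((φ k).hasCompactSupport_normed.mul_right)
  have hintc : ∀ k (c : ℝ), Integrable (fun t => (φ k).normed μ t * c) μ := fun k c =>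
    (φ k).integrable_normed.mul_const c
  have hc : ∀ k (c : ℝ), ∫ t, (φ k).normed μ t * c ∂μ = c := fun k c => by
    rw [integral_mul_const, (φ k).integral_normed, one_mul]
  have hnn : ∀ k t, 0 ≤ (φ k).normed μ t := fun k => (φ k).nonneg_normed
  have hval : ∀ k x, ((φ k).normed μ ⋆[ContinuousLinearMap.lsmul ℝ ℝ, μ] p) x =
      ∫ t, (φ k).normed μ t * p (x - t) ∂μ := fun k x => rfl
  refine ⟨fun k => (φ k).normed μ ⋆[ContinuousLinearMap.lsmul ℝ ℝ, μ] p, fun k => ?_,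
    fun k x => ?_, fun k x => ?_, fun k x => ?_, fun x => ?_⟩
  · exact (φ k).hasCompactSupport_normed.contDiff_convolution_left (n := 1) _
      (φ k).contDiff_normed hpc.locallyIntegrable
  · refine norm_fderiv_le_of_lipschitz ℝ (LipschitzWith.of_dist_le_mul fun x y => ?_)
    beta_reduce
    rw [hval, hval, dist_eq_norm, ← integral_sub (hint k x) (hint k y)]
    refine (norm_integral_le_of_norm_le (hintc k (K * dist x y)) (.of_forall fun t => ?_)).trans_eq
      (hc k _)
    rw [← mul_sub, norm_mul, Real.norm_of_nonneg (hnn k t), ← dist_eq_norm]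
    refine mul_le_mul_of_nonneg_left ?_ (hnn k t)
    simpa using hp.dist_le_mul (x - t) (y - t)
  · beta_reduce
    rw [hval, ← hc k a]
    exact integral_mono (hintc k a) (hint k x) fun t => mul_le_mul_of_nonneg_left (ha _) (hnn k t)
  · beta_reduce
    rw [hval, ← hc k b]
    exact integral_mono (hint k x) (hintc k b) fun t => mul_le_mul_of_nonneg_left (hb _) (hnn k t)
  · exact ContDiffBump.convolution_tendsto_right_of_continuous
      tendsto_one_div_add_atTop_nhds_zero_nat hpc x

section Modular

variable {E : Type*} [NormedAddCommGroup E] [MeasurableSpace E] [BorelSpace E] {μ : Measure E}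
  [IsFiniteMeasureOnCompacts μ] {w : E → ℝ}

lemma lintegral_abs_rpow_ne_top (hw : Continuous w) (hc : HasCompactSupport w) {c : ℝ}
    (h : 0 < c) : ∫⁻ x, ENNReal.ofReal (|w x| ^ c) ∂μ ≠ ⊤ := by
  have hcont : Continuous fun x => |w x| ^ c :=
    hw.abs.rpow continuous_const fun _ => Or.inr h
  have hcs : HasCompactSupport fun x => |w x| ^ c :=
    hc.comp_left (g := fun y : ℝ => |y| ^ c) (by simp [Real.zero_rpow h.ne'])
  exact (hcont.integrable_of_hasCompactSupport hcs).lintegral_lt_top.ne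

lemma rpow_le_rpow_add_rpow {y a b c : ℝ} (hy : 0 ≤ y) (ha : 0 < a) (hac : a ≤ c) (hcb : c ≤ b) :
    y ^ c ≤ y ^ a + y ^ b := by
  have h1 : 0 ≤ y ^ a := Real.rpow_nonneg hy _
  have h2 : 0 ≤ y ^ b := Real.rpow_nonneg hy _
  rcases le_total y 1 with h | h
  · linarith [Real.rpow_le_rpow_of_exponent_ge_of_imp hy h hac fun _ h' => absurd h' (by linarith)]
  · linarith [Real.rpow_le_rpow_of_exponent_le h hcb]

lemma lintegral_abs_rpow_variable_ne_top (hw : Continuous w) (hc : HasCompactSupport w)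
    {r : E → ℝ} {a b : ℝ} (ha : 0 < a) (har : ∀ x, a ≤ r x) (hrb : ∀ x, r x ≤ b) :
    ∫⁻ x, ENNReal.ofReal (|w x| ^ r x) ∂μ ≠ ⊤ := by
  have hb : 0 < b := ha.trans_le ((har 0).trans (hrb 0))
  refine ne_top_of_le_ne_top (ENNReal.add_ne_top.2
    ⟨lintegral_abs_rpow_ne_top (μ := μ) hw hc ha, lintegral_abs_rpow_ne_top (μ := μ) hw hc hb⟩) ?_
  rw [← lintegral_add_left (by fun_prop)]
  refine lintegral_mono fun x => ?_
  rw [← ENNReal.ofReal_add (by positivity) (by positivity)]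
  exact ENNReal.ofReal_le_ofReal (rpow_le_rpow_add_rpow (abs_nonneg _) ha (har x) (hrb x))

lemma tendsto_lintegral_abs_rpow (hw : Continuous w) (hc : HasCompactSupport w)
    {r : ℕ → E → ℝ} {r₀ : E → ℝ} {a b : ℝ} (ha : 0 < a) (hr : ∀ k, Continuous (r k))
    (har : ∀ k x, a ≤ r k x) (hrb : ∀ k x, r k x ≤ b)
    (hlim : ∀ x, Tendsto (fun k => r k x) atTop (𝓝 (r₀ x))) :
    Tendsto (fun k => ∫⁻ x, ENNReal.ofReal (|w x| ^ r k x) ∂μ) atTop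
      (𝓝 (∫⁻ x, ENNReal.ofReal (|w x| ^ r₀ x) ∂μ)) := by
  have hb : 0 < b := ha.trans_le ((har 0 0).trans (hrb 0 0))
  refine tendsto_lintegral_of_dominated_convergence
    (fun x => ENNReal.ofReal (|w x| ^ a) + ENNReal.ofReal (|w x| ^ b)) (fun k => ?_)
    (fun k => .of_forall fun x => ?_) ?_ (.of_forall fun x => ?_)
  · exact (ENNReal.continuous_ofReal.comp (hw.abs.rpow (hr k) fun x =>
      Or.inr (ha.trans_le (har k x)))).measurable
  · beta_reduce
    rw [← ENNReal.ofReal_add (by positivity) (by positivity)]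
    exact ENNReal.ofReal_le_ofReal (rpow_le_rpow_add_rpow (abs_nonneg _) ha (har k x) (hrb k x))
  · rw [lintegral_add_left (by fun_prop)]
    exact ENNReal.add_ne_top.2
      ⟨lintegral_abs_rpow_ne_top hw hc ha, lintegral_abs_rpow_ne_top hw hc hb⟩
  · have h0 : a ≤ r₀ x := ge_of_tendsto' (hlim x) fun k => har k x
    exact (ENNReal.continuous_ofReal.tendsto _).comp
      (tendsto_const_nhds.rpow (hlim x) (Or.inr (ha.trans_le h0)))

end Modular

/-- The derivative of `x ↦ (n - 1) q(x) / (n - q(x))` is bounded when `q` stays below `n` and has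
bounded derivative. -/
lemma contDiff_sobolevExponent {E : Type*} [NormedAddCommGroup E] [NormedSpace ℝ E] {n b K : ℝ}
    (hn : 1 < n) (hb : b < n) {q : E → ℝ}
    (hq : ContDiff ℝ 1 q) (hqK : ∀ x, ‖fderiv ℝ q x‖ ≤ K) (hqb : ∀ x, q x ≤ b) :
    ContDiff ℝ 1 (fun x => (n - 1) * q x / (n - q x)) ∧
      ∀ x, ‖fderiv ℝ (fun x => (n - 1) * q x / (n - q x)) x‖ ≤ (n - 1) * n / (n - b) ^ 2 * K := by
  have hne : ∀ x, n - q x ≠ 0 := fun x => by linarith [hqb x]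
  refine ⟨(contDiff_const.mul hq).div (contDiff_const.sub hq) hne, fun x => ?_⟩
  have hnb : 0 < n - b := by linarith
  have hd : HasDerivAt (fun y : ℝ => (n - 1) * y / (n - y)) ((n - 1) * n / (n - q x) ^ 2)
      (q x) := by
    convert! ((hasDerivAt_id (q x)).const_mul (n - 1)).div
      ((hasDerivAt_id (q x)).const_sub n) (hne x) using 1
    simp only [id]
    ring
  have hf := hd.comp_hasFDerivAt x (hq.differentiable one_ne_zero x).hasFDerivAt
  rw [show (fun x => (n - 1) * q x / (n - q x)) = (fun y : ℝ => (n - 1) * y / (n - y)) ∘ q from rfl,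
    hf.fderiv, norm_smul, Real.norm_of_nonneg (by
      have := hqb x
      exact div_nonneg (mul_nonneg (by linarith) (by linarith)) (sq_nonneg _))]
  have h1 : 0 ≤ (n - 1) * n := mul_nonneg (by linarith) (by linarith)
  have h2 := hqb x
  gcongr
  exact hqK x

section Critical

open Module

variable {E : Type*} [NormedAddCommGroup E] [InnerProductSpace ℝ E] [FiniteDimensional ℝ E]
  [MeasurableSpace E] [BorelSpace E]

/-- The modular form of the critical Sobolev inequality for a `C¹` exponent; the constants depend
on the exponent only through its bounds. -/
lemma exists_critical_modular_le_of_contDiff (μ : Measure E) [μ.IsAddHaarMeasure] {n a b K η : ℝ}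
    (hn : n = finrank ℝ E) (ha : 1 < a) (hab : a ≤ b) (hb : b < n) (hK : 0 ≤ K) (hη : 0 < η) :
    ∃ D : ℝ, 0 ≤ D ∧ ∀ q v : E → ℝ, ContDiff ℝ 1 q → (∀ x, ‖fderiv ℝ q x‖ ≤ K) →
      (∀ x, a ≤ q x) → (∀ x, q x ≤ b) → ContDiff ℝ 1 v → HasCompactSupport v →
      ∫⁻ x, ENNReal.ofReal (|v x| ^ (n * q x / (n - q x))) ∂μ ≤
        lintegralPowLePowLIntegralFDerivConst μ n.conjExponent *
          (ENNReal.ofReal η * ∫⁻ x, ENNReal.ofReal (|v x| ^ (n * q x / (n - q x))) ∂μ +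
            ENNReal.ofReal D * (∫⁻ x, ENNReal.ofReal (|v x| ^ q x) ∂μ +
              ∫⁻ x, ENNReal.ofReal (|‖fderiv ℝ v x‖| ^ q x) ∂μ)) ^ n.conjExponent := by
  have hn1 : 1 < n := by linarith
  have hconj : Real.HolderConjugate (finrank ℝ E) n.conjExponent :=
    hn ▸ Real.HolderConjugate.conjExponent hn1
  have hL : 0 ≤ (n - 1) * n / (n - b) ^ 2 * K :=
    mul_nonneg (div_nonneg (mul_nonneg (by linarith) (by linarith)) (sq_nonneg _)) hK
  obtain ⟨D, hD, hbound⟩ := exists_critical_absorption ha hb hab hL hη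
  refine ⟨D, hD, fun q v hq hqK hqa hqb hv hvc => ?_⟩
  obtain ⟨hs, hsL⟩ := contDiff_sobolevExponent hn1 hb hq hqK hqb
  set s : E → ℝ := fun x => (n - 1) * q x / (n - q x) with hsdef
  have hs1 : ∀ x, 1 < s x := fun x => by
    have h1 := hqa x
    have h2 := hqb x
    rw [hsdef, lt_div_iff₀ (by linarith)]
    nlinarith
  have hf := contDiff_one_abs_rpow hv hs hs1
  have hfc : HasCompactSupport fun x => |v x| ^ s x := by
    refine hvc.mono' fun x hx => subset_tsupport _ fun h0 => hx ?_
    simp [h0, Real.zero_rpow (show s x ≠ 0 by linarith [hs1 x])]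
  have hrc : Continuous fun x => |v x| ^ (n * q x / (n - q x)) := by
    refine hv.continuous.abs.rpow ((continuous_const.mul hq.continuous).div
      (continuous_const.sub hq.continuous) fun x => by linarith [hqb x]) fun x => Or.inr ?_
    have h1 := hqa x
    have h2 := hqb x
    exact div_pos (mul_pos (by linarith) (by linarith)) (by linarith)
  have hqc : Continuous fun x => |v x| ^ q x :=
    hv.continuous.abs.rpow hq.continuous fun x => Or.inr (by linarith [hqa x])
  have hsob := lintegral_pow_le_pow_lintegral_fderiv μ hf hfc hconj
  have hlhs : ∀ x, ‖|v x| ^ s x‖ₑ ^ n.conjExponent =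
      ENNReal.ofReal (|v x| ^ (n * q x / (n - q x))) := fun x => by
    rw [Real.enorm_of_nonneg (by positivity), ENNReal.ofReal_rpow_of_nonneg (by positivity)
      hconj.symm.nonneg, ← Real.rpow_mul (abs_nonneg _)]
    congr 2
    have h2 : n - q x ≠ 0 := by linarith [hqb x]
    have h3 : n - 1 ≠ 0 := by linarith
    rw [hsdef, Real.conjExponent]
    field_simp
  rw [lintegral_congr hlhs] at hsob
  refine hsob.trans ?_
  refine mul_le_mul_right (ENNReal.rpow_le_rpow ?_ hconj.symm.nonneg) _
  have hpt : ∀ x, ‖fderiv ℝ (fun x => |v x| ^ s x) x‖ₑ ≤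
      ENNReal.ofReal η * ENNReal.ofReal (|v x| ^ (n * q x / (n - q x))) +
        ENNReal.ofReal D * (ENNReal.ofReal (|v x| ^ q x) +
          ENNReal.ofReal (|‖fderiv ℝ v x‖| ^ q x)) := fun x => by
    rw [← ENNReal.ofReal_add (by positivity) (by positivity), ← ENNReal.ofReal_mul hη.le,
      ← ENNReal.ofReal_mul hD, ← ENNReal.ofReal_add (by positivity) (by positivity),
      ← ofReal_norm]
    refine ENNReal.ofReal_le_ofReal ?_
    rw [(hasFDerivAt_abs_rpow (hv.differentiable one_ne_zero x).hasFDerivAt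
      (hs.differentiable one_ne_zero x).hasFDerivAt (hs1 x)).fderiv, abs_norm]
    refine (norm_abs_rpow_smul_le (by linarith [hs1 x]) _ _).trans ?_
    refine le_trans ?_ (hbound (q x) |v x| ‖fderiv ℝ v x‖ (hqa x) (hqb x) (abs_nonneg _)
      (norm_nonneg _))
    rw [Real.log_abs]
    gcongr
    exact hsL x
  refine (lintegral_mono hpt).trans_eq ?_
  have hrm := (ENNReal.continuous_ofReal.comp hrc).measurable
  have hqm := (ENNReal.continuous_ofReal.comp hqc).measurable
  simp only [Function.comp_def] at hrm hqm
  rw [lintegral_add_left (hrm.const_mul _), lintegral_const_mul _ hrm,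
    lintegral_const_mul' _ _ ENNReal.ofReal_ne_top, lintegral_add_left hqm]

/-- The modular form of the critical Sobolev inequality for a Lipschitz exponent. -/
lemma exists_critical_modular_le (μ : Measure E) [μ.IsAddHaarMeasure] {n a b η : ℝ}
    (hn : n = finrank ℝ E) (ha : 1 < a) (hb : b < n) (hη : 0 < η) {p : E → ℝ} {K : NNReal}
    (hp : LipschitzWith K p) (hpa : ∀ x, a ≤ p x) (hpb : ∀ x, p x ≤ b) :
    ∃ D : ℝ, 0 ≤ D ∧ ∀ v : E → ℝ, ContDiff ℝ 1 v → HasCompactSupport v →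
      ∫⁻ x, ENNReal.ofReal (|v x| ^ (n * p x / (n - p x))) ∂μ ≤
        lintegralPowLePowLIntegralFDerivConst μ n.conjExponent *
          (ENNReal.ofReal η * ∫⁻ x, ENNReal.ofReal (|v x| ^ (n * p x / (n - p x))) ∂μ +
            ENNReal.ofReal D * (∫⁻ x, ENNReal.ofReal (|v x| ^ p x) ∂μ +
              ∫⁻ x, ENNReal.ofReal (|‖fderiv ℝ v x‖| ^ p x) ∂μ)) ^ n.conjExponent := by
  have hab : a ≤ b := (hpa 0).trans (hpb 0)
  obtain ⟨q, hq, hqK, hqa, hqb, hlim⟩ := hp.exists_contDiff_tendsto hpa hpb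
  obtain ⟨D, hD, hbound⟩ :=
    exists_critical_modular_le_of_contDiff μ hn ha hab hb K.coe_nonneg hη
  refine ⟨D, hD, fun v hv hvc => ?_⟩
  have hne : ∀ {t : ℝ}, t ≤ b → n - t ≠ 0 := fun h => by linarith
  have h1 := tendsto_lintegral_abs_rpow (μ := μ) hv.continuous hvc (zero_lt_one.trans ha)
    (fun k => (hq k).continuous) hqa hqb hlim
  have h2 := tendsto_lintegral_abs_rpow (μ := μ) (hv.continuous_fderiv one_ne_zero).norm
    (hvc.fderiv (𝕜 := ℝ)).norm (zero_lt_one.trans ha) (fun k => (hq k).continuous) hqa hqb hlim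
  have h3 : Tendsto (fun k => ∫⁻ x, ENNReal.ofReal (|v x| ^ (n * q k x / (n - q k x))) ∂μ) atTop
      (𝓝 (∫⁻ x, ENNReal.ofReal (|v x| ^ (n * p x / (n - p x))) ∂μ)) := by
    refine tendsto_lintegral_abs_rpow (a := n * a / n) (b := n * b / (n - b)) hv.continuous hvc
      (div_pos (mul_pos (by linarith) (by linarith)) (by linarith))
      (fun k => (continuous_const.mul (hq k).continuous).div
        (continuous_const.sub (hq k).continuous) fun x => hne (hqb k x)) (fun k x => ?_)
      (fun k x => ?_) (fun x => ((hlim x).const_mul n).div ((hlim x).const_sub n) (hne (hpb x)))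
    all_goals
      have h1 := hqa k x
      have h2 := hqb k x
    · exact div_le_div₀ (mul_nonneg (by linarith) (by linarith))
        (mul_le_mul_of_nonneg_left h1 (by linarith)) (by linarith) (by linarith)
    · exact div_le_div₀ (mul_nonneg (by linarith) (by linarith))
        (mul_le_mul_of_nonneg_left h2 (by linarith)) (by linarith) (by linarith)
  refine le_of_tendsto_of_tendsto' h3 ?_ fun k =>
    hbound (q k) v (hq k) (hqK k) (hqa k) (hqb k) hv hvc
  refine ENNReal.Tendsto.const_mul ?_ (Or.inr ENNReal.coe_ne_top)
  refine (ENNReal.continuous_rpow_const.tendsto _).comp ?_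
  exact (ENNReal.Tendsto.const_mul h3 (Or.inr ENNReal.ofReal_ne_top)).add
    (ENNReal.Tendsto.const_mul (h1.add h2) (Or.inr ENNReal.ofReal_ne_top))

/-- If the critical modular of `v` is larger than one but bounded, the modulars of `v` and of its
gradient cannot both be small. -/
lemma exists_le_modular_add_modular_fderiv (μ : Measure E) [μ.IsAddHaarMeasure] {n a b M : ℝ}
    (hn : n = finrank ℝ E) (ha : 1 < a) (hb : b < n) (hM : 0 < M) {p : E → ℝ} {K : NNReal}
    (hp : LipschitzWith K p) (hpa : ∀ x, a ≤ p x) (hpb : ∀ x, p x ≤ b) :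
    ∃ m : ℝ, 0 < m ∧ ∀ v : E → ℝ, ContDiff ℝ 1 v → HasCompactSupport v →
      1 < ∫⁻ x, ENNReal.ofReal (|v x| ^ (n * p x / (n - p x))) ∂μ →
      ∫⁻ x, ENNReal.ofReal (|v x| ^ (n * p x / (n - p x))) ∂μ ≤ ENNReal.ofReal M →
      ENNReal.ofReal m ≤ ∫⁻ x, ENNReal.ofReal (|v x| ^ p x) ∂μ +
        ∫⁻ x, ENNReal.ofReal (|‖fderiv ℝ v x‖| ^ p x) ∂μ := by
  have hn1 : 1 < n := by linarith [(hpa 0).trans (hpb 0)]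
  have hP : 0 < n.conjExponent := (Real.HolderConjugate.conjExponent hn1).symm.pos
  set P := n.conjExponent
  set C := lintegralPowLePowLIntegralFDerivConst μ P
  set κ : ℝ := ((C : ℝ) + 1)⁻¹ ^ P⁻¹
  have hκ : 0 < κ := by positivity
  set η := κ / (2 * M)
  have hη : 0 < η := by positivity
  obtain ⟨D, hD, hbound⟩ := exists_critical_modular_le μ hn ha hb hη hp hpa hpb
  refine ⟨η * M / (D + 1), by positivity, fun v hv hvc h1 hX => ?_⟩
  by_contra! hlt
  refine (hbound v hv hvc).not_gt (lt_of_le_of_lt ?_ h1)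
  have hsum : ENNReal.ofReal η * ∫⁻ x, ENNReal.ofReal (|v x| ^ (n * p x / (n - p x))) ∂μ +
      ENNReal.ofReal D * (∫⁻ x, ENNReal.ofReal (|v x| ^ p x) ∂μ +
        ∫⁻ x, ENNReal.ofReal (|‖fderiv ℝ v x‖| ^ p x) ∂μ) ≤ ENNReal.ofReal κ := by
    calc _ ≤ ENNReal.ofReal η * ENNReal.ofReal M +
          ENNReal.ofReal D * ENNReal.ofReal (η * M / (D + 1)) := by gcongr
      _ = ENNReal.ofReal (η * M + D * (η * M / (D + 1))) := by
        rw [← ENNReal.ofReal_mul hη.le, ← ENNReal.ofReal_mul hD,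
          ← ENNReal.ofReal_add (by positivity) (by positivity)]
      _ ≤ ENNReal.ofReal κ := by
        refine ENNReal.ofReal_le_ofReal ?_
        have e1 : η * M = κ / 2 := by simp only [η]; field_simp
        have e2 : D * (η * M / (D + 1)) ≤ η * M := by
          rw [mul_div_assoc', div_le_iff₀ (by positivity)]
          nlinarith [mul_pos hη hM]
        linarith
  calc _ ≤ (C : ENNReal) * ENNReal.ofReal κ ^ P := by gcongr
    _ = ENNReal.ofReal (C * ((C : ℝ) + 1)⁻¹) := by
      rw [ENNReal.ofReal_rpow_of_pos hκ, ← Real.rpow_mul (by positivity), inv_mul_cancel₀ hP.ne',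
        Real.rpow_one, ENNReal.ofReal_mul C.coe_nonneg, ENNReal.ofReal_coe_nnreal]
    _ ≤ 1 := by
      rw [ENNReal.ofReal_le_one, ← div_eq_mul_inv, div_le_one (by positivity)]
      linarith

end Critical

section LuxNorm

variable {N : ℕ} {Ω : Set (EuclideanSpace ℝ (Fin N))} {p w : EuclideanSpace ℝ (Fin N) → ℝ}

lemma luxNorm_nonneg : 0 ≤ luxNorm Ω p w := Real.sInf_nonneg fun _ h => h.1.le

lemma setLIntegral_abs_rpow_eq (hw : ∀ x ∉ Ω, w x = 0) (hp : ∀ x, 0 < p x) :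
    ∫⁻ x in Ω, ENNReal.ofReal (|w x| ^ p x) = ∫⁻ x, ENNReal.ofReal (|w x| ^ p x) :=
  setLIntegral_eq_of_support_subset fun x hx => by
    by_contra h
    exact hx (by simp [hw x h, Real.zero_rpow (hp x).ne'])

lemma lintegral_abs_mul_rpow_le {ν : Measure (EuclideanSpace ℝ (Fin N))} {θ : ℝ} (hθ : 0 ≤ θ)
    (hθ1 : θ ≤ 1) (hp : ∀ x, 1 ≤ p x) :
    ∫⁻ x, ENNReal.ofReal (|θ * w x| ^ p x) ∂ν ≤
      ENNReal.ofReal θ * ∫⁻ x, ENNReal.ofReal (|w x| ^ p x) ∂ν := by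
  rw [← lintegral_const_mul' _ _ ENNReal.ofReal_ne_top]
  refine lintegral_mono fun x => ?_
  rw [← ENNReal.ofReal_mul hθ, abs_mul, abs_of_nonneg hθ, Real.mul_rpow hθ (abs_nonneg _)]
  refine ENNReal.ofReal_le_ofReal (mul_le_mul_of_nonneg_right ?_ (by positivity))
  simpa using Real.rpow_le_rpow_of_exponent_ge_of_imp hθ hθ1 (hp x) fun _ h =>
    absurd h (by linarith [hp x])

lemma exists_modular_div_le_one (hw : ∫⁻ x in Ω, ENNReal.ofReal (|w x| ^ p x) ≠ ⊤)
    (hp : ∀ x, 1 ≤ p x) :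
    {α : ℝ | 0 < α ∧ (∫⁻ x in Ω, ENNReal.ofReal (|w x / α| ^ p x)) ≤ 1}.Nonempty := by
  set I := ∫⁻ x in Ω, ENNReal.ofReal (|w x| ^ p x)
  have hα : 0 < I.toReal + 1 := by positivity
  refine ⟨I.toReal + 1, hα, ?_⟩
  simp_rw [div_eq_inv_mul]
  refine (lintegral_abs_mul_rpow_le (by positivity)
    (inv_le_one_of_one_le₀ (by linarith [I.toReal_nonneg])) hp).trans ?_
  change ENNReal.ofReal _ * I ≤ 1
  rw [← ENNReal.ofReal_toReal hw, ← ENNReal.ofReal_mul (by positivity), ENNReal.ofReal_le_one,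
    ENNReal.toReal_ofReal ENNReal.toReal_nonneg, inv_mul_le_one₀ hα]
  linarith

lemma modular_div_le {α t : ℝ} (hα : 0 < α) (ht : 0 < t) (hαt : α ≤ t) (hp : ∀ x, 1 ≤ p x)
    (h : ∫⁻ x in Ω, ENNReal.ofReal (|w x / α| ^ p x) ≤ 1) :
    ∫⁻ x in Ω, ENNReal.ofReal (|w x / t| ^ p x) ≤ ENNReal.ofReal (α / t) := by
  have e : ∀ x, w x / t = α / t * (w x / α) := fun x => by field_simp
  simp_rw [e]
  refine (lintegral_abs_mul_rpow_le (by positivity) ((div_le_one ht).2 hαt) hp).trans ?_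
  calc _ ≤ ENNReal.ofReal (α / t) * 1 := by gcongr
    _ = _ := mul_one _

/-- The modular at half the Luxemburg norm exceeds one, and it is bounded in terms of the exponent
only. -/
lemma one_lt_modular_div_half_luxNorm {R : ℝ} (h : 0 < luxNorm Ω p w) (hp : ∀ x, 0 ≤ p x)
    (hR : ∀ x, p x ≤ R) :
    1 < ∫⁻ x in Ω, ENNReal.ofReal (|w x / (luxNorm Ω p w / 2)| ^ p x) ∧
      ∫⁻ x in Ω, ENNReal.ofReal (|w x / (luxNorm Ω p w / 2)| ^ p x) ≤
        ENNReal.ofReal (4 ^ R) := by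
  set l := luxNorm Ω p w
  set S := {α : ℝ | 0 < α ∧ (∫⁻ x in Ω, ENNReal.ofReal (|w x / α| ^ p x)) ≤ 1}
  have hlS : l = sInf S := rfl
  have hbdd : BddBelow S := ⟨0, fun _ h => h.1.le⟩
  constructor
  · by_contra! hle
    have := csInf_le hbdd (show l / 2 ∈ S from ⟨by positivity, hle⟩)
    linarith
  · have hne : S.Nonempty := by
      by_contra! h0
      rw [hlS, h0, Real.sInf_empty] at h
      exact h.false
    obtain ⟨γ, ⟨hγ, hγ1⟩, hγl⟩ := exists_lt_of_csInf_lt hne (show sInf S < 2 * l by linarith)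
    calc ∫⁻ x in Ω, ENNReal.ofReal (|w x / (l / 2)| ^ p x)
        ≤ ∫⁻ x in Ω, ENNReal.ofReal (4 ^ R) * ENNReal.ofReal (|w x / γ| ^ p x) := by
          refine lintegral_mono fun x => ?_
          rw [← ENNReal.ofReal_mul (by positivity)]
          refine ENNReal.ofReal_le_ofReal ?_
          have h1 : |w x / (l / 2)| ≤ 4 * |w x / γ| := by
            rw [abs_div, abs_div (w x) γ, abs_of_pos hγ, abs_of_pos (half_pos h), mul_div_assoc',
              div_le_div_iff₀ (by positivity) hγ]
            nlinarith [abs_nonneg (w x)]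
          calc |w x / (l / 2)| ^ p x ≤ (4 * |w x / γ|) ^ p x :=
                Real.rpow_le_rpow (abs_nonneg _) h1 (hp x)
            _ = 4 ^ p x * |w x / γ| ^ p x := Real.mul_rpow (by norm_num) (abs_nonneg _)
            _ ≤ 4 ^ R * |w x / γ| ^ p x := by
              gcongr
              · norm_num
              · exact hR x
      _ = ENNReal.ofReal (4 ^ R) * ∫⁻ x in Ω, ENNReal.ofReal (|w x / γ| ^ p x) :=
          lintegral_const_mul' _ _ ENNReal.ofReal_ne_top
      _ ≤ ENNReal.ofReal (4 ^ R) * 1 := by gcongr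
      _ = _ := mul_one _

end LuxNorm

/-- (Sobolev inequality, Proposition 2.3.) Let `p : ℝ^N → ℝ` be Lipschitz with
`1 < inf p ≤ sup p < N`, let `p*(x) = N·p(x)/(N − p(x))`, and let `Ω ⊆ ℝ^N` be open. Then there
is `c > 0` with `|u|_{p*(·)} ≤ c·(|u|_{p(·)} + |∇u|_{p(·)})` for every `u ∈ C_c^∞(Ω)`. -/
theorem sobolev_inequality_variable_exponent {N : ℕ} (hN : 1 ≤ N)
    (p : EuclideanSpace ℝ (Fin N) → ℝ) (K : NNReal) (hLip : LipschitzWith K p)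
    (hbdd : BddAbove (Set.range p))
    (hinf : 1 < sInf (Set.range p))
    (hsup : sSup (Set.range p) < N)
    (Ω : Set (EuclideanSpace ℝ (Fin N))) (hΩ : IsOpen Ω) :
    ∃ c : ℝ, 0 < c ∧ ∀ u : EuclideanSpace ℝ (Fin N) → ℝ,
      ContDiff ℝ (⊤ : ℕ∞) u → HasCompactSupport u → tsupport u ⊆ Ω →
      luxNorm Ω (fun x => (N : ℝ) * p x / ((N : ℝ) - p x)) u ≤
        c * (luxNorm Ω p u + luxNorm Ω p (fun x => ‖fderiv ℝ u x‖)) := by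
  set a := sInf (Set.range p)
  set b := sSup (Set.range p)
  have hbelow : BddBelow (Set.range p) := by
    by_contra h
    have : a = 0 := Real.sInf_of_not_bddBelow h
    linarith
  have hpa : ∀ x, a ≤ p x := fun x => csInf_le hbelow ⟨x, rfl⟩
  have hpb : ∀ x, p x ≤ b := fun x => le_csSup hbdd ⟨x, rfl⟩
  have hp1 : ∀ x, 1 ≤ p x := fun x => hinf.le.trans (hpa x)
  have hr0 : ∀ x, 0 < N * p x / (N - p x) := fun x => by
    have h1 := hp1 x
    have h2 := hpb x
    exact div_pos (mul_pos (by linarith) (by linarith)) (by linarith)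
  have hrR : ∀ x, N * p x / (N - p x) ≤ N * b / (N - b) := fun x => by
    have h1 := hp1 x
    have h2 := hpb x
    exact div_le_div₀ (mul_nonneg (by linarith) (by linarith))
      (mul_le_mul_of_nonneg_left h2 (by linarith)) (by linarith) (by linarith)
  obtain ⟨m, hm, hmod⟩ := exists_le_modular_add_modular_fderiv (n := N)
    (M := 4 ^ (N * b / (N - b))) (volume : Measure (EuclideanSpace ℝ (Fin N))) (by simp)
    hinf hsup (by positivity) hLip hpa hpb
  have hm1 : 0 < min m 1 := lt_min hm one_pos
  refine ⟨2 / min m 1, by positivity, fun u hu huc hus => ?_⟩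
  have hu1 : ContDiff ℝ 1 u := hu.of_le (by exact_mod_cast le_top)
  have hu0 : ∀ x ∉ Ω, u x = 0 := fun x hx => image_eq_zero_of_notMem_tsupport fun h => hx (hus h)
  have hg0 : ∀ x ∉ Ω, ‖fderiv ℝ u x‖ = 0 := fun x hx => by
    rw [norm_eq_zero]
    by_contra h
    exact hx (hus (support_fderiv_subset ℝ h))
  by_contra! hlt
  set A := luxNorm Ω p u
  set B := luxNorm Ω p (fun x => ‖fderiv ℝ u x‖)
  set l := luxNorm Ω (fun x => (N : ℝ) * p x / ((N : ℝ) - p x)) u with hl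
  have hAB : A + B < min m 1 * (l / 2) := by
    rw [div_mul_eq_mul_div, div_lt_iff₀ hm1] at hlt
    linarith
  have hA0 : 0 ≤ A := luxNorm_nonneg
  have hB0 : 0 ≤ B := luxNorm_nonneg
  have hl0 : 0 < l := by
    have := (add_nonneg hA0 hB0).trans_lt hAB
    linarith [(pos_iff_pos_of_mul_pos this).1 hm1]
  obtain ⟨h1, h2⟩ := one_lt_modular_div_half_luxNorm hl0 (fun x => (hr0 x).le) hrR
  rw [← hl] at h1 h2
  set t := l / 2
  have ht : 0 < t := half_pos hl0
  set ε := (min m 1 * t - A - B) / 2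
  have hε : 0 < ε := by simp only [ε]; linarith
  have hp0 : ∀ x, 0 < p x := fun x => one_pos.trans_le (hp1 x)
  obtain ⟨α, ⟨hα, hα1⟩, hαA⟩ := exists_lt_of_csInf_lt (exists_modular_div_le_one (Ω := Ω) (w := u)
    (by
      rw [setLIntegral_abs_rpow_eq hu0 hp0]
      exact lintegral_abs_rpow_variable_ne_top hu1.continuous huc one_pos hp1 hpb) hp1)
    (show _ < A + ε from lt_add_of_pos_right A hε)
  obtain ⟨β, ⟨hβ, hβ1⟩, hβB⟩ := exists_lt_of_csInf_lt (exists_modular_div_le_one (Ω := Ω)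
    (w := fun x => ‖fderiv ℝ u x‖)
    (by
      rw [setLIntegral_abs_rpow_eq hg0 hp0]
      exact lintegral_abs_rpow_variable_ne_top (hu1.continuous_fderiv one_ne_zero).norm
        (huc.fderiv (𝕜 := ℝ)).norm one_pos hp1 hpb) hp1)
    (show _ < B + ε from lt_add_of_pos_right B hε)
  have hαβ : α + β < min m 1 * t := by simp only [ε] at hαA hβB; linarith
  have hmt : min m 1 * t ≤ t := mul_le_of_le_one_left ht.le (min_le_right _ _)
  have hαm := modular_div_le hα ht (by linarith) hp1 hα1
  have hβm := modular_div_le hβ ht (by linarith) hp1 hβ1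
  have hv0 : ∀ x ∉ Ω, u x / t = 0 := fun x hx => by rw [hu0 x hx, zero_div]
  have hgv0 : ∀ x ∉ Ω, ‖fderiv ℝ u x‖ / t = 0 := fun x hx => by rw [hg0 x hx, zero_div]
  rw [setLIntegral_abs_rpow_eq hv0 hr0] at h1 h2
  rw [setLIntegral_abs_rpow_eq hv0 hp0] at hαm
  rw [setLIntegral_abs_rpow_eq hgv0 hp0] at hβm
  have hvc : HasCompactSupport fun x => u x / t :=
    huc.comp_left (g := fun y : ℝ => y / t) (zero_div t)
  have key := hmod (fun x => u x / t) (hu1.div_const t) hvc h1 h2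
  have hfd : ∀ x, ‖fderiv ℝ (fun x => u x / t) x‖ = ‖fderiv ℝ u x‖ / t := fun x => by
    simp_rw [div_eq_mul_inv]
    rw [fderiv_mul_const (hu1.differentiable one_ne_zero x), norm_smul, norm_inv,
      Real.norm_of_nonneg ht.le, mul_comm]
  simp_rw [hfd] at key
  have hlast := key.trans (add_le_add hαm hβm)
  rw [← ENNReal.ofReal_add (by positivity) (by positivity),
    ENNReal.ofReal_le_ofReal_iff (by positivity), ← add_div, le_div_iff₀ ht] at hlast
  have : min m 1 * t ≤ m * t := mul_le_mul_of_nonneg_right (min_le_left _ _) ht.le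
  linarith
end
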